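/- arXiv:2207.11425 — 5 statements merged into one kernel-verified Lean document; each statement's English description precedes it below -/
import Mathlib

section
/- Let P_π ∈ {0,1}^{2N×2N} be the permutation matrix of the permutation π of {1,…,2N} defined by π(i) = (i−1)/2 + 1 if i is odd and π(i) = N + i/2 if i is even, i.e., P_π(i,j) = 1 exactly when j = π(i). Then A = diag(Q,Q) · P_πᵀ · blockdiag(A(λ₁),…,A(λ_N)) · P_π · diag(Qᵀ,Qᵀ), and B = diag(Q,Q) · P_πᵀ · blockdiag(B(λ₁),…,B(λ_N)) · Qᵀ, where blockdiag(A(λ₁),…,A(λ_N)) is the 2N×2N block-diagonal matrix with 2×2 diagonal blocks A(λᵢ), blockdiag(B(λ₁),…,B(λ_N)) is the 2N×N block-diagonal matrix with 2×1 diagonal blocks B(λᵢ), and diag(Q,Q) denotes the 2N×2N block-diagonal matrix with both diagonal blocks equal to Q. -/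
open Matrix

/-- Multiplying on the left by the transpose of the interleaving matrix stacks the two row slices. -/
theorem transpose_interleave_mul {n m R : Type*} [Fintype n] [DecidableEq n] [Semiring R]
    (M : Matrix (Fin 2 × n) m R) :
    (Matrix.of fun (p : Fin 2 × n) (j : n ⊕ n) =>
        if (if p.1 = 0 then (Sum.inl p.2 : n ⊕ n) else Sum.inr p.2) = j then (1 : R) else 0)ᵀ * M =
      Matrix.fromRows (Matrix.of fun i k => M (0, i) k) (Matrix.of fun i k => M (1, i) k) := by
  ext (i | i) k <;> simp [Matrix.mul_apply, Fintype.sum_prod_type]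

/-- Multiplying on the right by the interleaving matrix puts the two column slices side by side. -/
theorem mul_interleave {n m R : Type*} [Fintype n] [DecidableEq n] [Semiring R]
    (M : Matrix m (Fin 2 × n) R) :
    M * (Matrix.of fun (p : Fin 2 × n) (j : n ⊕ n) =>
        if (if p.1 = 0 then (Sum.inl p.2 : n ⊕ n) else Sum.inr p.2) = j then (1 : R) else 0) =
      Matrix.fromCols (Matrix.of fun k i => M k (0, i)) (Matrix.of fun k i => M k (1, i)) := by
  ext k (i | i) <;> simp [Matrix.mul_apply, Fintype.sum_prod_type]

/-- Let `L = QΛQᵀ` be a spectral decomposition of a real symmetric `N×N`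
matrix, and let `A`, `B` be the block matrices of the SDA linear system. With `P_π` the
permutation matrix interleaving the two blocks (odd index `i ↦ (i−1)/2 + 1`, even index
`i ↦ N + i/2`), one has
`A = diag(Q,Q) · P_πᵀ · blockdiag(A(λ₁),…,A(λ_N)) · P_π · diag(Qᵀ,Qᵀ)` and
`B = diag(Q,Q) · P_πᵀ · blockdiag(B(λ₁),…,B(λ_N)) · Qᵀ`.
Here the interleaved index set `{1,…,2N}` is modelled by `Fin 2 × Fin N` (pair = (position
within block, block)), and the stacked index set by `Fin N ⊕ Fin N`. -/
theorem sda_block_diagonalization {N : ℕ} (hN : 2 ≤ N)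
    (L Q : Matrix (Fin N) (Fin N) ℝ) (lam : Fin N → ℝ)
    (hQ : Qᵀ * Q = 1) (hL : L = Q * Matrix.diagonal lam * Qᵀ) (η ζ : ℝ) :
    let A : Matrix (Fin N ⊕ Fin N) (Fin N ⊕ Fin N) ℝ :=
      Matrix.fromBlocks (1 - (η * (1 + ζ)) • L) ((ζ ^ 2) • 1) (-(η • L)) (ζ • 1)
    let B : Matrix (Fin N ⊕ Fin N) (Fin N) ℝ := Matrix.fromRows ((1 + ζ) • L) L
    let A2 : ℝ → Matrix (Fin 2) (Fin 2) ℝ :=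
      fun l => !![1 - η * (1 + ζ) * l, ζ ^ 2; -(η * l), ζ]
    let B2 : ℝ → Fin 2 → ℝ := fun l => ![(1 + ζ) * l, l]
    let Pπ : Matrix (Fin 2 × Fin N) (Fin N ⊕ Fin N) ℝ :=
      Matrix.of fun p j =>
        if (if p.1 = 0 then (Sum.inl p.2 : Fin N ⊕ Fin N) else Sum.inr p.2) = j then 1 else 0
    let QQ : Matrix (Fin N ⊕ Fin N) (Fin N ⊕ Fin N) ℝ := Matrix.fromBlocks Q 0 0 Q
    let QQt : Matrix (Fin N ⊕ Fin N) (Fin N ⊕ Fin N) ℝ := Matrix.fromBlocks Qᵀ 0 0 Qᵀ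
    let blockB : Matrix (Fin 2 × Fin N) (Fin N) ℝ :=
      Matrix.of fun p k => if p.2 = k then B2 (lam k) p.1 else 0
    A = QQ * Pπᵀ * Matrix.blockDiagonal (fun i => A2 (lam i)) * Pπ * QQt ∧
    B = QQ * Pπᵀ * blockB * Qᵀ := by
  intro A B A2 B2 Pπ QQ QQt blockB
  have hQ' : Q * Qᵀ = 1 := mul_eq_one_comm.mp hQ
  have hA : Pπᵀ * Matrix.blockDiagonal (fun i => A2 (lam i)) * Pπ =
      Matrix.fromBlocks (1 - (η * (1 + ζ)) • Matrix.diagonal lam) ((ζ ^ 2) • 1)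
        (-(η • Matrix.diagonal lam)) (ζ • 1) := by
    rw [transpose_interleave_mul, mul_interleave]
    ext (i | i) (j | j) <;> by_cases h : i = j <;>
      simp [A2, Matrix.blockDiagonal_apply, h]
  have hB : Pπᵀ * blockB =
      Matrix.fromRows ((1 + ζ) • Matrix.diagonal lam) (Matrix.diagonal lam) := by
    rw [transpose_interleave_mul]
    ext (i | i) j <;> by_cases h : i = j <;> simp [B2, blockB, h]
  constructor
  · rw [Matrix.mul_assoc QQ, Matrix.mul_assoc QQ, hA]
    simp [A, QQ, QQt, hL, Matrix.fromBlocks_multiply, Matrix.mul_sub, Matrix.sub_mul, hQ']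
  · rw [Matrix.mul_assoc QQ, hB]
    simp [B, QQ, hL, Matrix.fromBlocks_mul_fromRows, Matrix.fromRows_mul]
end

section
/- Suppose λ satisfies λ₁/κ ≤ λ ≤ λ₁. Then for every integer k ≥ 0, the (1,1) entry of the k-th power of A(λ) satisfies |[A(λ)^k]_{1,1}| ≤ (1 + k/(√κ + 1)) (1 − 1/√κ)^k (with the convention 0⁰ = 1). -/
open Polynomial in
/-- On `[-1, 1]` the Chebyshev polynomials of the second kind satisfy `|Uₙ(x)| ≤ n + 1`. -/
theorem abs_eval_U_real_le {x : ℝ} (hx : |x| ≤ 1) (n : ℕ) :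
    |(Chebyshev.U ℝ n).eval x| ≤ n + 1 := by
  induction n with
  | zero => simp
  | succ n ih =>
    have hT := Chebyshev.abs_eval_T_real_le_one ((n : ℤ) + 1) hx
    push_cast
    rw [Chebyshev.U_eq_X_mul_U_add_T, eval_add, eval_mul, eval_X]
    refine (abs_add_le _ _).trans (add_le_add ?_ hT)
    rw [abs_mul]
    exact (mul_le_of_le_one_left (abs_nonneg _) hx).trans ih

/-- Cayley–Hamilton for `2 × 2` matrices, as a recurrence for powers. -/
theorem Matrix.pow_add_two_fin_two {R : Type*} [CommRing R] (M : Matrix (Fin 2) (Fin 2) R)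
    (n : ℕ) : M ^ (n + 2) = M.trace • M ^ (n + 1) - M.det • M ^ n := by
  have h : M ^ 2 = M.trace • M - M.det • (1 : Matrix (Fin 2) (Fin 2) R) := by
    ext i j
    fin_cases i <;> fin_cases j <;>
      simp [pow_two, Matrix.mul_apply, Matrix.trace_fin_two, Matrix.det_fin_two] <;> ring
  rw [pow_add, h, mul_sub, mul_smul_comm, mul_smul_comm, mul_one, ← pow_succ]

open Polynomial in
/-- Closed form, in terms of Chebyshev polynomials, of a second-order linear recurrence whose
characteristic roots are `q c (c ± √(c² - 1))`. -/
theorem eq_chebyshev_of_recurrence {a : ℕ → ℝ} {q c p : ℝ} (h0 : a 0 = 1)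
    (h1 : a 1 = q * (2 * c ^ 2 - p))
    (hrec : ∀ n, a (n + 2) = 2 * q * c ^ 2 * a (n + 1) - q ^ 2 * c ^ 2 * a n) (n : ℕ) :
    a (n + 1) = q ^ (n + 1) * (c ^ n *
      ((Chebyshev.T ℝ (n + 2)).eval c + (1 - p) * (Chebyshev.U ℝ n).eval c)) := by
  induction n using Nat.twoStepInduction with
  | zero => simp [h1, Chebyshev.T_two]
  | one =>
    have hT : Chebyshev.T ℝ 3 = 2 * X * Chebyshev.T ℝ 2 - Chebyshev.T ℝ 1 :=
      Chebyshev.T_add_two ℝ 1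
    norm_num [hrec 0, h0, h1, hT, Chebyshev.T_two]
    ring
  | more n ih₀ ih₁ =>
    have hT := congrArg (eval c) (Chebyshev.T_add_two ℝ ((n : ℤ) + 2))
    have hU := congrArg (eval c) (Chebyshev.U_add_two ℝ (n : ℤ))
    simp only [eval_sub, eval_mul, eval_X, eval_ofNat] at hT hU
    rw [hrec, ih₀, ih₁]
    push_cast
    rw [show (n : ℤ) + 1 + 2 = n + 2 + 1 by ring, hT, hU]
    ring

theorem abs_le_of_recurrence {a : ℕ → ℝ} {q c p : ℝ} (hq : 0 ≤ q) (hc : |c| ≤ 1) (hp : p ≤ 1)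
    (h0 : a 0 = 1) (h1 : a 1 = q * (2 * c ^ 2 - p))
    (hrec : ∀ n, a (n + 2) = 2 * q * c ^ 2 * a (n + 1) - q ^ 2 * c ^ 2 * a n) (n : ℕ) :
    |a n| ≤ (1 + n * (1 - p)) * q ^ n := by
  cases n with
  | zero => simp [h0]
  | succ n =>
    have hp' : 0 ≤ 1 - p := sub_nonneg.2 hp
    rw [eq_chebyshev_of_recurrence h0 h1 hrec, abs_mul, abs_of_nonneg (pow_nonneg hq _), mul_comm]
    refine mul_le_mul_of_nonneg_right ?_ (pow_nonneg hq _)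
    rw [abs_mul, abs_pow]
    refine (mul_le_of_le_one_left (abs_nonneg _) (pow_le_one₀ (abs_nonneg _) hc)).trans ?_
    refine (abs_add_le _ _).trans
      (add_le_add (Polynomial.Chebyshev.abs_eval_T_real_le_one _ hc) ?_)
    rw [abs_mul, abs_of_nonneg hp', mul_comm]
    push_cast
    exact mul_le_mul_of_nonneg_right (abs_eval_U_real_le hc n) hp'

/-- With `η = 1/λ₁`, `ζ = (√κ − 1)/(√κ + 1)` and
`A(λ) = [[1 − η(1+ζ)λ, ζ²], [−ηλ, ζ]]`, if `λ₁/κ ≤ λ ≤ λ₁` then for every `k ≥ 0`,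
`|[A(λ)^k]_{1,1}| ≤ (1 + k/(√κ + 1)) (1 − 1/√κ)^k`. -/
theorem abs_pow_entry_one_one_le (lam1 κ lam : ℝ) (hlam1 : 0 < lam1) (hκ : 1 ≤ κ)
    (hlo : lam1 / κ ≤ lam) (hhi : lam ≤ lam1) (k : ℕ) :
    let η : ℝ := 1 / lam1
    let ζ : ℝ := (Real.sqrt κ - 1) / (Real.sqrt κ + 1)
    let Alam : Matrix (Fin 2) (Fin 2) ℝ := !![1 - η * (1 + ζ) * lam, ζ ^ 2; -(η * lam), ζ]
    |(Alam ^ k) 0 0| ≤ (1 + (k : ℝ) / (Real.sqrt κ + 1)) * (1 - 1 / Real.sqrt κ) ^ k := by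
  intro η ζ Alam
  set s := Real.sqrt κ
  have hs1 : 1 ≤ s := Real.one_le_sqrt.2 hκ
  have hs0 : 0 < s := by linarith
  have hκs : κ = s ^ 2 := (Real.sq_sqrt (by linarith)).symm
  have hlow : 1 / s ^ 2 ≤ η * lam := by
    rw [← hκs]
    calc 1 / κ = η * (lam1 / κ) := by simp only [η]; field_simp
      _ ≤ η * lam := mul_le_mul_of_nonneg_left hlo (by positivity)
  have hhigh : η * lam ≤ 1 := by
    simp only [η]
    rw [one_div_mul_eq_div]
    exact (div_le_one hlam1).2 hhi
  obtain ⟨c, hc, hx⟩ : ∃ c : ℝ, |c| ≤ 1 ∧ η * lam = 1 - c ^ 2 * (1 - 1 / s ^ 2) := by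
    rcases hs1.eq_or_lt with h | h
    · refine ⟨0, by simp, ?_⟩
      rw [← h] at hlow
      norm_num at hlow ⊢
      linarith
    · have hd : 0 < 1 - 1 / s ^ 2 := by
        rw [sub_pos, div_lt_one (by positivity)]
        nlinarith
      have hr : 0 ≤ (1 - η * lam) / (1 - 1 / s ^ 2) := div_nonneg (by linarith) hd.le
      refine ⟨√((1 - η * lam) / (1 - 1 / s ^ 2)), ?_, ?_⟩
      · rw [abs_of_nonneg (Real.sqrt_nonneg _), Real.sqrt_le_iff, one_pow, div_le_one hd]
        exact ⟨zero_le_one, by linarith⟩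
      · rw [Real.sq_sqrt hr, div_mul_cancel₀ _ hd.ne']
        ring
  have hA : Alam = !![1 - (1 + ζ) * (η * lam), ζ ^ 2; -(η * lam), ζ] := by
    simp only [Alam]
    rw [show η * (1 + ζ) * lam = (1 + ζ) * (η * lam) by ring]
  rw [hx] at hA
  have htrace : Alam.trace = 2 * (1 - 1 / s) * c ^ 2 := by
    rw [hA, Matrix.trace_fin_two_of]
    simp only [ζ]
    field_simp
    ring
  have hdet : Alam.det = (1 - 1 / s) ^ 2 * c ^ 2 := by
    rw [hA, Matrix.det_fin_two_of]
    simp only [ζ]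
    field_simp
    ring
  have key := abs_le_of_recurrence (a := fun n => (Alam ^ n) 0 0) (q := 1 - 1 / s) (c := c)
    (p := s / (s + 1)) (sub_nonneg.2 ((div_le_one hs0).2 hs1)) hc
    ((div_le_one (by linarith)).2 (by linarith)) (by simp)
    (by
      simp only [pow_one, hA, Matrix.of_apply, Matrix.cons_val_zero, ζ]
      field_simp
      ring)
    (fun n => by
      simp only [Matrix.pow_add_two_fin_two Alam n, htrace, hdet, Matrix.sub_apply,
        Matrix.smul_apply, smul_eq_mul]) k
  convert key using 3
  field_simp
  ring
end

section
/- Suppose λ satisfies λ₁/κ ≤ λ ≤ λ₁. Then for all integers j ≥ k ≥ 0, |[A(λ)^k]_{1,2} · [A(λ)^j]_{2,1}| ≤ (1 + k/(√κ + 1)) (1 − 1/√κ)^k (with the convention 0⁰ = 1), where [A(λ)^m]_{r,s} denotes the (r,s) entry of the m-th power of A(λ). -/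
/-- `cheb p n = cos θ ^ (n - 1) * sin (n θ) / sin θ` with `p = cos² θ`, as a recursive sequence. -/
def cheb (p : ℝ) : ℕ → ℝ
  | 0 => 0
  | 1 => 1
  | n + 2 => 2 * p * cheb p (n + 1) - p * cheb p n

lemma cheb_quadratic (p : ℝ) (n : ℕ) :
    cheb p (n + 1) ^ 2 - 2 * p * cheb p (n + 1) * cheb p n + p * cheb p n ^ 2 = p ^ n := by
  induction n with
  | zero => simp [cheb]
  | succ n ih =>
    rw [pow_succ p, ← ih, cheb]
    ring

lemma one_sub_mul_cheb_sq_le_one {p : ℝ} (hp0 : 0 ≤ p) (hp1 : p ≤ 1) (n : ℕ) :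
    (1 - p) * cheb p (n + 1) ^ 2 ≤ 1 := by
  have h := cheb_quadratic p n
  have hpow : p ^ n ≤ 1 := pow_le_one₀ hp0 hp1
  nlinarith [mul_nonneg hp0 (sq_nonneg (cheb p (n + 1) - cheb p n))]

lemma abs_cheb_le {p : ℝ} (hp0 : 0 ≤ p) (hp1 : p ≤ 1) (n : ℕ) : |cheb p n| ≤ n := by
  induction n with
  | zero => simp [cheb]
  | succ n ih =>
    have h := cheb_quadratic p n
    have hpow : p ^ n ≤ 1 := pow_le_one₀ hp0 hp1
    have hdiff : |cheb p (n + 1) - p * cheb p n| ≤ 1 := by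
      rw [← sq_le_one_iff_abs_le_one]
      nlinarith [mul_nonneg (mul_nonneg hp0 (sub_nonneg.2 hp1)) (sq_nonneg (cheb p n))]
    have hmul : |p * cheb p n| ≤ n := by
      rw [abs_mul, abs_of_nonneg hp0]
      exact (mul_le_of_le_one_left (abs_nonneg _) hp1).trans ih
    calc |cheb p (n + 1)| = |(cheb p (n + 1) - p * cheb p n) + p * cheb p n| := by ring_nf
      _ ≤ 1 + n := (abs_add_le _ _).trans (add_le_add hdiff hmul)
      _ = ((n + 1 : ℕ) : ℝ) := by push_cast; ring

lemma one_sub_mul_abs_cheb_mul_cheb_le_one {p : ℝ} (hp0 : 0 ≤ p) (hp1 : p ≤ 1) (m n : ℕ) :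
    (1 - p) * |cheb p (m + 1) * cheb p (n + 1)| ≤ 1 := by
  have hm := one_sub_mul_cheb_sq_le_one hp0 hp1 m
  have hn := one_sub_mul_cheb_sq_le_one hp0 hp1 n
  rw [← sq_abs] at hm hn
  rw [abs_mul]
  nlinarith [mul_nonneg (sub_nonneg.2 hp1) (sq_nonneg (|cheb p (m + 1)| - |cheb p (n + 1)|))]

lemma pow_succ_eq_cheb {R : Type*} [Ring R] [Algebra ℝ R] {a : R} {ρ p : ℝ}
    (ha : a * a = (2 * ρ * p) • a - (ρ ^ 2 * p) • (1 : R)) (n : ℕ) :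
    a ^ (n + 1) = (ρ ^ n * cheb p (n + 1)) • a - (ρ ^ (n + 1) * p * cheb p n) • (1 : R) := by
  induction n with
  | zero => simp [cheb]
  | succ n ih =>
    rw [pow_succ, ih, sub_mul, smul_mul_assoc, smul_mul_assoc, one_mul, ha, cheb]
    module

lemma natCast_mul_pow_le {s : ℝ} (hs : 1 ≤ s) (n : ℕ) : n * (1 - 1 / s) ^ n ≤ s - 1 := by
  have hs0 : 0 < s := by linarith
  have hρ : 0 ≤ 1 - 1 / s := sub_nonneg.2 ((div_le_one hs0).2 hs)
  suffices h : (1 - 1 / s) ^ n * (s - 1 + n) ≤ s - 1 by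
    nlinarith [mul_nonneg (pow_nonneg hρ n) (sub_nonneg.2 hs)]
  induction n with
  | zero => simp
  | succ n ih =>
    refine le_trans ?_ ih
    rw [pow_succ, mul_assoc]
    refine mul_le_mul_of_nonneg_left ?_ (pow_nonneg hρ n)
    have hn : (0 : ℝ) ≤ n / s := by positivity
    have : (1 - 1 / s) * (s - 1 + (n + 1 : ℕ)) = s - 1 + n - n / s := by
      push_cast
      field_simp
      ring
    linarith


/-- With `η = 1/λ₁`, `ζ = (√κ − 1)/(√κ + 1)` and
`A(λ) = [[1 − η(1+ζ)λ, ζ²], [−ηλ, ζ]]`, if `λ₁/κ ≤ λ ≤ λ₁` then for all integers `j ≥ k ≥ 0`,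
`|[A(λ)^k]_{1,2} · [A(λ)^j]_{2,1}| ≤ (1 + k/(√κ + 1)) (1 − 1/√κ)^k`. -/
theorem abs_pow_entry_offdiag_mul_le (lam1 κ lam : ℝ) (hlam1 : 0 < lam1) (hκ : 1 ≤ κ)
    (hlo : lam1 / κ ≤ lam) (hhi : lam ≤ lam1) (j k : ℕ) (hjk : k ≤ j) :
    let η : ℝ := 1 / lam1
    let ζ : ℝ := (Real.sqrt κ - 1) / (Real.sqrt κ + 1)
    let Alam : Matrix (Fin 2) (Fin 2) ℝ := !![1 - η * (1 + ζ) * lam, ζ ^ 2; -(η * lam), ζ]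
    |(Alam ^ k) 0 1 * (Alam ^ j) 1 0|
      ≤ (1 + (k : ℝ) / (Real.sqrt κ + 1)) * (1 - 1 / Real.sqrt κ) ^ k := by
  intro η ζ Alam
  set s := Real.sqrt κ
  have hs : 1 ≤ s := Real.one_le_sqrt.2 hκ
  have hs0 : 0 < s := by linarith
  have hκs : κ = s ^ 2 := (Real.sq_sqrt (by linarith)).symm
  have hρ : 0 ≤ 1 - 1 / s := sub_nonneg.2 ((div_le_one hs0).2 hs)
  have hrhs : 0 ≤ (1 + (k : ℝ) / (s + 1)) * (1 - 1 / s) ^ k := by positivity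
  rcases k.eq_zero_or_pos with rfl | hk
  · simp
  obtain ⟨m, rfl⟩ : ∃ m, k = m + 1 := ⟨k - 1, by omega⟩
  obtain ⟨n, rfl⟩ : ∃ n, j = n + 1 := ⟨j - 1, by omega⟩
  have hxlo : 1 ≤ s ^ 2 * (η * lam) := by
    rw [hκs, div_le_iff₀ (by positivity)] at hlo
    rw [show s ^ 2 * (η * lam) = lam * s ^ 2 / lam1 by simp only [η]; ring, le_div_iff₀ hlam1]
    linarith
  have hxhi : η * lam ≤ 1 := by
    rw [show η * lam = lam / lam1 by simp only [η]; ring]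
    exact (div_le_one hlam1).2 hhi
  have hA : Alam = !![1 - (1 + ζ) * (η * lam), ζ ^ 2; -(η * lam), ζ] := by
    simp only [Alam]; congr! 4; ring
  clear_value Alam η
  generalize η * lam = x at hA hxlo hxhi
  have hζ : ζ = (s - 1) / (s + 1) := rfl
  clear_value ζ s
  rcases hs.eq_or_lt with hs1 | hs1
  · have hζ : ζ = 0 := by simp [hζ, ← hs1]
    have hx : x = 1 := by rw [← hs1] at hxlo; linarith
    have hsq : Alam * Alam = (2 * 0 * 0 : ℝ) • Alam - ((0 : ℝ) ^ 2 * 0) • 1 := by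
      subst hA
      ext a b
      fin_cases a <;> fin_cases b <;> simp [hζ, hx]
    rw [pow_succ_eq_cheb hsq m]
    simpa [hA, hζ] using hrhs
  have hs2 : 0 < s ^ 2 - 1 := by nlinarith
  obtain ⟨p, hp⟩ : ∃ p, p = s ^ 2 * (1 - x) / (s ^ 2 - 1) := ⟨_, rfl⟩
  have hp0 : 0 ≤ p := hp ▸ div_nonneg (mul_nonneg (by positivity) (by linarith)) hs2.le
  have hp1 : p ≤ 1 := hp ▸ (div_le_one hs2).2 (by linarith)
  have hx : x = (1 + (s ^ 2 - 1) * (1 - p)) / s ^ 2 := by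
    rw [hp]
    field_simp
    ring
  have hsq : Alam * Alam
      = (2 * (1 - 1 / s) * p) • Alam - ((1 - 1 / s) ^ 2 * p) • (1 : Matrix _ _ ℝ) := by
    subst hA
    ext a b
    fin_cases a <;> fin_cases b <;>
      simp [Matrix.mul_apply, Fin.sum_univ_two, hx, hζ] <;> field_simp <;> ring
  have hentry : (Alam ^ (m + 1)) 0 1 * (Alam ^ (n + 1)) 1 0
      = -((1 - 1 / s) ^ (m + 1) * (1 - 1 / s) ^ (n + 1) *
          ((1 + (s ^ 2 - 1) * (1 - p)) / (s + 1) ^ 2) * (cheb p (m + 1) * cheb p (n + 1))) := by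
    have hcoef : ζ ^ 2 * x
        = (1 - 1 / s) ^ 2 * ((1 + (s ^ 2 - 1) * (1 - p)) / (s + 1) ^ 2) := by
      rw [hx, hζ]
      field_simp
    rw [pow_succ_eq_cheb hsq m, pow_succ_eq_cheb hsq n]
    simp only [hA, Matrix.sub_apply, Matrix.smul_apply, smul_eq_mul, Matrix.of_apply,
      Matrix.cons_val', Matrix.cons_val_zero, Matrix.cons_val_one, Matrix.cons_val_fin_one,
      Matrix.one_apply_ne (zero_ne_one' (Fin 2)), Matrix.one_apply_ne (one_ne_zero (α := Fin 2))]
    linear_combination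
      (-(1 - 1 / s) ^ m * (1 - 1 / s) ^ n * cheb p (m + 1) * cheb p (n + 1)) * hcoef
  have hcoef : 0 ≤ (1 + (s ^ 2 - 1) * (1 - p)) / (s + 1) ^ 2 :=
    div_nonneg (by nlinarith [mul_nonneg hs2.le (sub_nonneg.2 hp1)]) (by positivity)
  rw [hentry, abs_neg, abs_mul, abs_of_nonneg (by positivity)]
  have hV : |cheb p (m + 1) * cheb p (n + 1)| ≤ (m + 1 : ℕ) * (n + 1 : ℕ) := by
    rw [abs_mul]
    exact mul_le_mul (abs_cheb_le hp0 hp1 _) (abs_cheb_le hp0 hp1 _) (abs_nonneg _) (by positivity)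
  have hW := one_sub_mul_abs_cheb_mul_cheb_le_one hp0 hp1 m n
  have hn := natCast_mul_pow_le hs (n + 1)
  have hρn : (1 - 1 / s) ^ (n + 1) ≤ 1 := pow_le_one₀ hρ (by linarith [one_div_pos.2 hs0])
  have hρn0 : 0 ≤ (1 - 1 / s) ^ (n + 1) := pow_nonneg hρ _
  generalize (1 - 1 / s) ^ (n + 1) = q at *
  generalize |cheb p (m + 1) * cheb p (n + 1)| = V at *
  generalize ((n + 1 : ℕ) : ℝ) = J at *
  have hK : (0 : ℝ) ≤ (m + 1 : ℕ) := Nat.cast_nonneg _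
  generalize ((m + 1 : ℕ) : ℝ) = K at *
  have hfirst : q * V ≤ K * (s + 1) := by
    nlinarith [mul_le_mul_of_nonneg_left hV hρn0, mul_le_mul_of_nonneg_left hn hK]
  have hsecond : q * ((s ^ 2 - 1) * ((1 - p) * V)) ≤ (s + 1) ^ 2 := by
    have := mul_le_mul_of_nonneg_left hW hs2.le
    have := mul_le_mul_of_nonneg_left this hρn0
    nlinarith
  have hmain : q * ((1 + (s ^ 2 - 1) * (1 - p)) / (s + 1) ^ 2) * V ≤ 1 + K / (s + 1) := by
    rw [show q * ((1 + (s ^ 2 - 1) * (1 - p)) / (s + 1) ^ 2) * V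
        = (q * V + q * ((s ^ 2 - 1) * ((1 - p) * V))) / (s + 1) ^ 2 by ring,
      div_le_iff₀ (by positivity)]
    have : (1 + K / (s + 1)) * (s + 1) ^ 2 = (s + 1) ^ 2 + K * (s + 1) := by
      field_simp
    linarith
  nlinarith [mul_le_mul_of_nonneg_left hmain (pow_nonneg hρ (m + 1))]
end

section
/- Suppose κ > 1 and let r = 1 − 1/√κ. Then for every integer k ≥ 1, the k-th power of A(λ₁/κ) is given explicitly by A(λ₁/κ)^k = [[ (1 + k/(√κ+1)) r^k , k ζ² r^{k−1} ], [ −(k/κ) r^{k−1} , (1 − k/(√κ+1)) r^k ]]. -/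
/-- Powers of a `2 × 2` matrix with the double eigenvalue `r`. -/
theorem pow_succ_of_double_eigenvalue {R : Type*} [CommRing R] (r b c d : R)
    (h : r ^ 2 * c ^ 2 = b * d) (n : ℕ) :
    (!![(1 + c) * r, b; -d, (1 - c) * r] : Matrix (Fin 2) (Fin 2) R) ^ (n + 1)
      = !![(1 + (n + 1) * c) * r ^ (n + 1), (n + 1) * b * r ^ n;
           -((n + 1) * d) * r ^ n, (1 - (n + 1) * c) * r ^ (n + 1)] := by
  induction n with
  | zero => simp
  | succ n ih =>
    rw [pow_succ, ih, Matrix.mul_fin_two]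
    push_cast
    congrm !![?_, ?_; ?_, ?_]
    · linear_combination (n + 1) * r ^ n * h
    · ring
    · ring
    · linear_combination (n + 1) * r ^ n * h

/-- For `κ > 1`, `η = 1/λ₁`, `ζ = (√κ − 1)/(√κ + 1)` and `r = 1 − 1/√κ`,
the `k`-th power (`k ≥ 1`) of `A(λ₁/κ)` is given explicitly by
`A(λ₁/κ)^k = [[(1 + k/(√κ+1)) r^k, k ζ² r^{k−1}], [−(k/κ) r^{k−1}, (1 − k/(√κ+1)) r^k]]`. -/
theorem pow_A_lam_min (lam1 κ : ℝ) (hlam1 : 0 < lam1) (hκ : 1 < κ) (k : ℕ) (hk : 1 ≤ k) :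
    let s : ℝ := Real.sqrt κ
    let ζ : ℝ := (s - 1) / (s + 1)
    let η : ℝ := 1 / lam1
    let r : ℝ := 1 - 1 / s
    let lam : ℝ := lam1 / κ
    (!![1 - η * (1 + ζ) * lam, ζ ^ 2; -(η * lam), ζ] : Matrix (Fin 2) (Fin 2) ℝ) ^ k
      = !![(1 + (k : ℝ) / (s + 1)) * r ^ k, (k : ℝ) * ζ ^ 2 * r ^ (k - 1);
           -((k : ℝ) / κ) * r ^ (k - 1), (1 - (k : ℝ) / (s + 1)) * r ^ k] := by
  intro s ζ η r lam
  have hs : 0 < s := Real.sqrt_pos.2 (by linarith)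
  have hsκ : κ = s ^ 2 := (Real.sq_sqrt (by linarith)).symm
  have hηlam : η * lam = 1 / s ^ 2 := by
    simp only [η, lam, ← hsκ]
    field_simp
  have hA : (!![1 - η * (1 + ζ) * lam, ζ ^ 2; -(η * lam), ζ] : Matrix (Fin 2) (Fin 2) ℝ)
      = !![(1 + 1 / (s + 1)) * r, ζ ^ 2; -(1 / s ^ 2), (1 - 1 / (s + 1)) * r] := by
    rw [mul_right_comm, hηlam]
    congrm !![?_, _; _, ?_]
    all_goals
      simp only [ζ, r]
      field_simp
      ring
  have hdet : r ^ 2 * (1 / (s + 1)) ^ 2 = ζ ^ 2 * (1 / s ^ 2) := by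
    simp only [ζ, r]
    field_simp
  obtain ⟨n, rfl⟩ := Nat.exists_eq_add_of_le' hk
  rw [hA, pow_succ_of_double_eigenvalue r (ζ ^ 2) (1 / (s + 1)) (1 / s ^ 2) hdet n, hsκ]
  simp [div_eq_mul_inv]
end

section
/- For every real κ > 1, 1 + 1/(2(√κ − 1)) ≥ e^{1/(2√κ)}. -/
/-- For every real `κ > 1`, `1 + 1/(2(√κ − 1)) ≥ e^{1/(2√κ)}`. -/
theorem exp_le_one_add_inv (κ : ℝ) (hκ : 1 < κ) :
    Real.exp (1 / (2 * Real.sqrt κ)) ≤ 1 + 1 / (2 * (Real.sqrt κ - 1)) := by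
  have hs : 1 < Real.sqrt κ := Real.lt_sqrt_of_sq_lt (by linarith)
  generalize Real.sqrt κ = s at hs ⊢
  have hx : 1 / (2 * s) < 1 := by
    rw [div_lt_one (by linarith)]
    linarith
  calc Real.exp (1 / (2 * s))
      ≤ 1 / (1 - 1 / (2 * s)) := Real.exp_bound_div_one_sub_of_interval (by positivity) hx
    _ = 1 + 1 / (2 * s - 1) := by
      have h₁ : 2 * s - 1 ≠ 0 := by linarith
      have h₂ : 1 - 1 / (2 * s) ≠ 0 := by linarith
      field_simp
      ring
    _ ≤ 1 + 1 / (2 * (s - 1)) := by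
      exact add_le_add_right (one_div_le_one_div_of_le (by linarith) (by linarith)) 1
end
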